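/- Let Y be a countable discrete metric space of bounded geometry, i.e. for every r > 0 there is N_r ∈ ℕ with #(Y ∩ B_r(y)) ≤ N_r for all y ∈ Y. Represent C₀(Y) on H = ℓ²(Y) ⊗ ℓ²(ℕ) by multiplication on the first factor, and let C*_red(Y) denote the operator-norm closure in B(H) of the *-algebra ℝ(Y) of locally compact, finite propagation operators. Regard A = ℓ∞(Y; K(ℓ²(ℕ))), acting diagonally on H, as a C*-subalgebra of B(H); then A ⊆ ℝ(Y). Every approximate unit of A is an approximate unit of C*_red(Y): for every net (u_i) in A with 0 ≤ u_i ≤ 1 and ‖u_i a − a‖ → 0 for all a ∈ A, and every T ∈ C*_red(Y), one has ‖u_i T − T‖ → 0 and ‖T u_i − T‖ → 0. -/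

import Mathlib

open scoped ZeroAtInfty
open Metric Filter

noncomputable section

/-- `ℓ²(ℕ)`. -/
abbrev L2N : Type := lp (fun _ : ℕ => ℂ) 2

/-- `ℓ²(Y) ⊗ ℓ²(ℕ)`, realised as `ℓ²(Y, ℓ²(ℕ))`. -/
abbrev L2YN (Y : Type*) : Type _ := lp (fun _ : Y => L2N) 2

variable {Y : Type*} [MetricSpace Y]

/-- `T` has propagation at most `r` with respect to the representation `ρ` of `C₀(Y)`. -/
def HasPropLE (ρ : C₀(Y, ℂ) →⋆ₙₐ[ℂ] (L2YN Y →L[ℂ] L2YN Y)) (T : L2YN Y →L[ℂ] L2YN Y)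
    (r : ℝ) : Prop :=
  ∀ f g : C₀(Y, ℂ),
    (∀ x ∈ tsupport ⇑f, ∀ y ∈ tsupport ⇑g, r ≤ dist x y) → ρ f * T * ρ g = 0

/-- `T` is locally compact with respect to `ρ`. -/
def IsLocCompactOp (ρ : C₀(Y, ℂ) →⋆ₙₐ[ℂ] (L2YN Y →L[ℂ] L2YN Y))
    (T : L2YN Y →L[ℂ] L2YN Y) : Prop :=
  ∀ f : C₀(Y, ℂ), IsCompactOperator ⇑(ρ f * T) ∧ IsCompactOperator ⇑(T * ρ f)

/-- The algebraic Roe algebra `ℝ(Y)`: locally compact, finite propagation operators. -/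
def RoeAlgSet (ρ : C₀(Y, ℂ) →⋆ₙₐ[ℂ] (L2YN Y →L[ℂ] L2YN Y)) : Set (L2YN Y →L[ℂ] L2YN Y) :=
  {T | IsLocCompactOp ρ T ∧ ∃ r : ℝ, 0 ≤ r ∧ HasPropLE ρ T r}

/-- The block-diagonal algebra `ℓ∞(Y; K(ℓ²ℕ))` acting on `ℓ²(Y) ⊗ ℓ²(ℕ)`: operators given
by a bounded family of compact operators, acting diagonally. -/
def DiagCompactSet (Y : Type*) [MetricSpace Y] : Set (L2YN Y →L[ℂ] L2YN Y) :=
  {T | ∃ k : Y → (L2N →L[ℂ] L2N), (∀ y, IsCompactOperator ⇑(k y)) ∧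
    ∀ (v : L2YN Y) (y : Y), (T v) y = k y (v y)}

open scoped ENNReal InnerProductSpace

/-- The adjoint of a compact operator between Hilbert spaces is compact. -/
theorem IsCompactOperator.adjoint {E F : Type*} [NormedAddCommGroup E] [InnerProductSpace ℂ E]
    [CompleteSpace E] [NormedAddCommGroup F] [InnerProductSpace ℂ F] [CompleteSpace F]
    {T : E →L[ℂ] F} (hT : IsCompactOperator ⇑T) :
    IsCompactOperator ⇑(ContinuousLinearMap.adjoint T) := by
  set S := ContinuousLinearMap.adjoint T with hS
  have hTS : IsCompactOperator ⇑(T ∘L S : F →L[ℂ] F) := hT.comp_clm S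
  have key (x : F) : ‖S x‖ ^ 2 ≤ ‖(T ∘L S) x‖ * ‖x‖ := by
    have h : ⟪S x, S x⟫_ℂ = ⟪(T ∘L S) x, x⟫_ℂ := by
      rw [hS, ContinuousLinearMap.adjoint_inner_right]; rfl
    calc ‖S x‖ ^ 2 = ‖⟪S x, S x⟫_ℂ‖ := by simp [inner_self_eq_norm_sq_to_K]
      _ ≤ ‖(T ∘L S) x‖ * ‖x‖ := by rw [h]; exact norm_inner_le_norm _ _
  refine (isCompactOperator_iff_isCompact_closure_image_closedBall (S : F →ₗ[ℂ] E) one_pos).2 ?_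
  have htb : TotallyBounded ((T ∘L S) '' closedBall 0 1) :=
    (hTS.isCompact_closure_image_closedBall (f := ((T ∘L S : F →L[ℂ] F) : F →ₗ[ℂ] F))
      1).totallyBounded.subset subset_closure
  refine TotallyBounded.isCompact_of_isClosed (TotallyBounded.closure ?_) isClosed_closure
  refine Metric.totallyBounded_iff.2 fun ε hε => ?_
  obtain ⟨t, hts, htf, htc⟩ := Metric.finite_approx_of_totallyBounded htb (ε ^ 2 / 2) (by positivity)
  choose! g hg using (show ∀ z ∈ t, ∃ w ∈ closedBall (0 : F) 1, (T ∘L S) w = z from hts)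
  refine ⟨(fun z => S (g z)) '' t, htf.image _, ?_⟩
  rintro _ ⟨x, hx, rfl⟩
  obtain ⟨z, hz, hxz⟩ := Set.mem_iUnion₂.1 (htc ⟨x, hx, rfl⟩)
  refine Set.mem_iUnion₂.2 ⟨S (g z), ⟨z, hz, rfl⟩, ?_⟩
  have h1 : ‖(T ∘L S) (x - g z)‖ < ε ^ 2 / 2 := by
    rw [map_sub, (hg z hz).2, ← dist_eq_norm]; exact hxz
  have h2 : ‖x - g z‖ ≤ 2 := by
    have ha := mem_closedBall_zero_iff.1 hx
    have hb := mem_closedBall_zero_iff.1 (hg z hz).1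
    linarith [norm_sub_le x (g z)]
  have h3 : ‖S (x - g z)‖ ^ 2 < ε ^ 2 := by
    nlinarith [key (x - g z), norm_nonneg ((T ∘L S) (x - g z)), norm_nonneg (x - g z)]
  have h4 := lt_of_pow_lt_pow_left₀ 2 hε.le h3
  rw [map_sub, ← dist_eq_norm] at h4
  exact h4

theorem List.sum_range_elim_getElem {α M : Type*} [AddCommMonoid M] (f : α → M) (l : List α)
    {N : ℕ} (hN : l.length ≤ N) :
    ∑ k ∈ Finset.range N, (l[k]?).elim 0 f = (l.map f).sum := by
  induction l generalizing N with
  | nil => simp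
  | cons a l ih =>
    obtain ⟨N, rfl⟩ : ∃ M, N = M + 1 := ⟨N - 1, by simp at hN; omega⟩
    rw [Finset.sum_range_succ', List.map_cons, List.sum_cons, add_comm (f a)]
    simp [ih (N := N) (by simpa using hN)]

open Classical in
theorem Finset.sum_option_elim_le {α β : Type*} {f : α → ℝ} (hf : ∀ a, 0 ≤ f a) {φ : β → Option α}
    {N : ℕ} (hφ : ∀ (s : Finset β) (a : α), (s.filter fun b => φ b = some a).card ≤ N) {C : ℝ}
    (hC : ∀ t : Finset α, ∑ a ∈ t, f a ≤ C) (s : Finset β) :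
    ∑ b ∈ s, (φ b).elim 0 f ≤ N * C := by
  rw [Finset.sum_comp (fun o : Option α => o.elim 0 f) φ]
  calc ∑ o ∈ s.image φ, (s.filter fun b => φ b = o).card • o.elim 0 f
      ≤ ∑ o ∈ s.image φ, N * o.elim 0 f := by
        refine Finset.sum_le_sum fun o _ => ?_
        rcases o with _ | a
        · simp
        · rw [nsmul_eq_mul]
          exact mul_le_mul_of_nonneg_right (by exact_mod_cast hφ s a) (hf a)
    _ ≤ ∑ o ∈ Finset.insertNone (s.image φ).eraseNone, N * o.elim 0 f := by
        refine Finset.sum_le_sum_of_subset_of_nonneg ?_ fun o _ _ => ?_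
        · simp [Finset.subset_insert]
        · rcases o with _ | a
          · simp
          · exact mul_nonneg (by positivity) (hf a)
    _ ≤ N * C := by
        rw [← Finset.mul_sum, Finset.sum_insertNone]
        simpa using mul_le_mul_of_nonneg_left (hC _) (Nat.cast_nonneg N)

omit [MetricSpace Y] in
/-- A weighted composition operator along a partially defined map with uniformly finite fibres. -/
theorem exists_weightedComp {φ : Y → Option Y} {N : ℕ}
    (hφ : ∀ y : Y, {x | φ x = some y}.Finite ∧ {x | φ x = some y}.ncard ≤ N)
    {k : Y → (L2N →L[ℂ] L2N)} {C : ℝ} (hk : ∀ x, ‖k x‖ ≤ C) :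
    ∃ W : L2YN Y →L[ℂ] L2YN Y, ∀ v x, W v x = (φ x).elim 0 fun y => k x (v y) := by
  classical
  rcases isEmpty_or_nonempty Y with hY | ⟨⟨y₀⟩⟩
  · exact ⟨0, fun v x => isEmptyElim x⟩
  have hC : 0 ≤ C := (norm_nonneg _).trans (hk y₀)
  have hcard (s : Finset Y) (y : Y) : (s.filter fun x => φ x = some y).card ≤ N := by
    rw [← Set.ncard_coe_finset]
    exact (Set.ncard_le_ncard (by intro x; simp) (hφ y).1).trans (hφ y).2
  have h2 : 0 < (2 : ℝ≥0∞).toReal := by norm_num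
  have hsum (v : L2YN Y) (s : Finset Y) :
      ∑ x ∈ s, ‖(φ x).elim 0 fun y => k x (v y)‖ ^ (2 : ℝ≥0∞).toReal ≤
        (C * (N * ‖v‖)) ^ (2 : ℝ≥0∞).toReal := by
    have h := Finset.sum_option_elim_le (f := fun y => ‖v y‖ ^ (2 : ℝ≥0∞).toReal)
      (fun _ => by positivity) hcard (fun t => lp.sum_rpow_le_norm_rpow h2 v t) s
    calc _ ≤ ∑ x ∈ s, C ^ 2 * (φ x).elim 0 fun y => ‖v y‖ ^ (2 : ℝ≥0∞).toReal := by
          refine Finset.sum_le_sum fun x _ => ?_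
          rcases φ x with _ | y
          · simp
          · have := (k x).le_of_opNorm_le (hk x) (v y)
            simp only [Option.elim_some, ENNReal.toReal_ofNat, Real.rpow_ofNat]
            rw [← mul_pow]
            gcongr
      _ ≤ C ^ 2 * (N * ‖v‖ ^ (2 : ℝ≥0∞).toReal) := by
          rw [← Finset.mul_sum]; gcongr
      _ ≤ _ := by
          have hN : (N : ℝ) ≤ (N : ℝ) ^ 2 := by exact_mod_cast Nat.le_self_pow two_ne_zero N
          simp only [ENNReal.toReal_ofNat, Real.rpow_ofNat]
          rw [mul_pow, mul_pow]
          gcongr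
  let L : L2YN Y →ₗ[ℂ] L2YN Y :=
    { toFun := fun v => ⟨fun x => (φ x).elim 0 fun y => k x (v y), memℓp_gen' (hsum v)⟩
      map_add' := fun v w => by
        ext1; funext x
        change (φ x).elim 0 (fun y => k x (v y + w y)) =
          (φ x).elim 0 (fun y => k x (v y)) + (φ x).elim 0 (fun y => k x (w y))
        rcases φ x with _ | y <;> simp
      map_smul' := fun c v => by
        ext1; funext x
        change (φ x).elim 0 (fun y => k x (c • v y)) =
          c • (φ x).elim 0 (fun y => k x (v y))
        rcases φ x with _ | y <;> simp }
  refine ⟨L.mkContinuous (C * N) fun v => ?_, fun v x => rfl⟩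
  rw [mul_assoc]
  exact lp.norm_le_of_forall_sum_le h2 (by positivity) (hsum v)

open Classical in
/-- The `(x, y)` matrix entry of an operator on `ℓ²(Y) ⊗ ℓ²(ℕ)`. -/
def matrixEntry (T : L2YN Y →L[ℂ] L2YN Y) (x y : Y) : L2N →L[ℂ] L2N :=
  lp.evalCLM ℂ (fun _ : Y => L2N) 2 x ∘L T ∘L
    lp.singleContinuousLinearMap ℂ (fun _ : Y => L2N) 2 y

omit [MetricSpace Y] in
open Classical in
theorem matrixEntry_apply (T : L2YN Y →L[ℂ] L2YN Y) (x y : Y) (w : L2N) :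
    matrixEntry T x y w = T (lp.single 2 y w) x := rfl

omit [MetricSpace Y] in
theorem norm_matrixEntry_le (T : L2YN Y →L[ℂ] L2YN Y) (x y : Y) : ‖matrixEntry T x y‖ ≤ ‖T‖ := by
  classical
  refine ContinuousLinearMap.opNorm_le_bound _ (norm_nonneg _) fun w => ?_
  rw [matrixEntry_apply, ← lp.norm_single (p := 2) (E := fun _ : Y => L2N) (by norm_num) y w]
  exact (lp.norm_apply_le_norm two_ne_zero _ _).trans (T.le_opNorm _)

omit [MetricSpace Y] in
theorem hasSum_matrixEntry (T : L2YN Y →L[ℂ] L2YN Y) (v : L2YN Y) (x : Y) :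
    HasSum (fun y => matrixEntry T x y (v y)) (T v x) := by
  classical
  exact (lp.hasSum_single ENNReal.ofNat_ne_top v).mapL
    (lp.evalCLM ℂ (fun _ : Y => L2N) 2 x ∘L T)

omit [MetricSpace Y] in
theorem matrixEntry_adjoint (T : L2YN Y →L[ℂ] L2YN Y) (x y : Y) :
    matrixEntry (ContinuousLinearMap.adjoint T) x y =
      ContinuousLinearMap.adjoint (matrixEntry T y x) := by
  classical
  refine ContinuousLinearMap.ext fun w => ext_inner_left ℂ fun z => ?_
  rw [ContinuousLinearMap.adjoint_inner_right, matrixEntry_apply, matrixEntry_apply,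
    ← lp.inner_single_left (𝕜 := ℂ) (G := fun _ : Y => L2N),
    ContinuousLinearMap.adjoint_inner_right, lp.inner_single_right]

/-- Operators of finite propagation with compact matrix entries. -/
def BandCompact (T : L2YN Y →L[ℂ] L2YN Y) : Prop :=
  (∀ x y, IsCompactOperator ⇑(matrixEntry T x y)) ∧
    ∃ r : ℝ, 0 < r ∧ ∀ x y, r ≤ dist x y → matrixEntry T x y = 0

theorem BandCompact.adjoint {T : L2YN Y →L[ℂ] L2YN Y} (hT : BandCompact T) :
    BandCompact (ContinuousLinearMap.adjoint T) := by
  obtain ⟨hc, r, hr, h⟩ := hT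
  refine ⟨fun x y => ?_, r, hr, fun x y hxy => ?_⟩
  · rw [matrixEntry_adjoint]; exact (hc y x).adjoint
  · rw [matrixEntry_adjoint, h y x (by rwa [dist_comm]), map_zero]

/-- In bounded geometry, an operator of finite propagation with compact entries is a finite sum of
products whose left factors lie in the diagonal algebra. -/
theorem BandCompact.exists_eq_sum
    (hbg : ∀ r : ℝ, 0 < r → ∃ N : ℕ, ∀ y : Y,
      (Metric.ball y r).Finite ∧ (Metric.ball y r).ncard ≤ N)
    {T : L2YN Y →L[ℂ] L2YN Y} (hT : BandCompact T) :
    ∃ (N : ℕ) (a V : ℕ → L2YN Y →L[ℂ] L2YN Y), (∀ k, a k ∈ DiagCompactSet Y) ∧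
      T = ∑ k ∈ Finset.range N, a k * V k := by
  classical
  obtain ⟨hc, r, hr, hprop⟩ := hT
  obtain ⟨N, hN⟩ := hbg r hr
  let l : Y → List Y := fun x => (hN x).1.toFinset.toList
  have hl (x y : Y) : y ∈ l x ↔ dist y x < r := by simp [l]
  have hlen (x : Y) : (l x).length ≤ N := by
    have := (hN x).2
    rwa [Set.ncard_eq_toFinset_card _ (hN x).1, ← Finset.length_toList] at this
  have hV (k : ℕ) : ∃ V : L2YN Y →L[ℂ] L2YN Y, ∀ v x, V v x = ((l x)[k]?).elim 0 fun y => v y := by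
    refine exists_weightedComp (φ := fun x => (l x)[k]?) (N := N) (fun y => ?_)
      (k := fun _ => ContinuousLinearMap.id ℂ L2N) (fun _ => le_rfl)
    have hsub : {x | (l x)[k]? = some y} ⊆ Metric.ball y r := fun x hx => by
      rw [mem_ball, dist_comm]
      exact (hl x y).1 (List.mem_of_getElem? hx)
    exact ⟨(hN y).1.subset hsub, (Set.ncard_le_ncard hsub (hN y).1).trans (hN y).2⟩
  have ha (k : ℕ) : ∃ a : L2YN Y →L[ℂ] L2YN Y,
      ∀ v x, a v x = (((l x)[k]?).elim 0 fun y => matrixEntry T x y) (v x) := by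
    refine exists_weightedComp (φ := some) (N := 1) (fun y => by simp) (C := ‖T‖) fun x => ?_
    rcases (l x)[k]? with _ | y
    · simp
    · exact norm_matrixEntry_le T x y
  choose V hV using hV
  choose a ha using ha
  refine ⟨N, a, V, fun k => ⟨_, fun x => ?_, ha k⟩, ContinuousLinearMap.ext fun v => ?_⟩
  · rcases (l x)[k]? with _ | y
    · exact isCompactOperator_zero
    · exact hc x y
  · ext1; funext x
    have h1 : T v x = ∑ y ∈ (hN x).1.toFinset, matrixEntry T x y (v y) := by
      refine (hasSum_matrixEntry T v x).unique (hasSum_sum_of_ne_finset_zero fun y hy => ?_)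
      have hy : r ≤ dist x y := by simpa [dist_comm] using hy
      rw [hprop x y hy, zero_apply]
    have h2 (k : ℕ) : a k (V k v) x = ((l x)[k]?).elim 0 fun y => matrixEntry T x y (v y) := by
      rw [ha, hV]
      rcases (l x)[k]? with _ | y <;> simp
    rw [h1, _root_.sum_apply, lp.coeFn_sum, Finset.sum_apply]
    simp only [mul_apply_eq_comp, h2]
    rw [List.sum_range_elim_getElem _ _ (hlen x), Finset.sum_map_toList]

theorem tendsto_norm_mul_sub_of_bandCompact
    (hbg : ∀ r : ℝ, 0 < r → ∃ N : ℕ, ∀ y : Y,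
      (Metric.ball y r).Finite ∧ (Metric.ball y r).ncard ≤ N)
    {ι : Type*} {l : Filter ι} {u : ι → L2YN Y →L[ℂ] L2YN Y}
    (hu : ∀ a ∈ DiagCompactSet Y, Tendsto (fun i => ‖u i * a - a‖) l (nhds 0))
    {T : L2YN Y →L[ℂ] L2YN Y} (hT : BandCompact T) :
    Tendsto (fun i => ‖u i * T - T‖) l (nhds 0) := by
  obtain ⟨N, a, V, ha, rfl⟩ := hT.exists_eq_sum hbg
  have h0 : Tendsto (fun i => ∑ k ∈ Finset.range N, ‖u i * a k - a k‖ * ‖V k‖) l (nhds 0) := by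
    simpa using tendsto_finsetSum (Finset.range N) fun k _ =>
      (hu (a k) (ha k)).mul_const ‖V k‖
  refine squeeze_zero (fun _ => norm_nonneg _) (fun i => ?_) h0
  rw [Finset.mul_sum, ← Finset.sum_sub_distrib]
  refine norm_sum_le_of_le _ fun k _ => ?_
  rw [← mul_assoc, ← sub_mul]
  exact norm_mul_le _ _

theorem tendsto_norm_mul_sub_of_mem_closure {A ι : Type*} [NormedRing A] {l : Filter ι} {u : ι → A}
    (hu : ∀ i, ‖u i‖ ≤ 1) {s : Set A}
    (hs : ∀ a ∈ s, Tendsto (fun i => ‖u i * a - a‖) l (nhds 0)) {a : A} (ha : a ∈ closure s) :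
    Tendsto (fun i => ‖u i * a - a‖) l (nhds 0) := by
  rw [Metric.tendsto_nhds]
  intro ε hε
  obtain ⟨b, hb, hab⟩ := Metric.mem_closure_iff.1 ha (ε / 3) (by positivity)
  filter_upwards [Metric.tendsto_nhds.1 (hs b hb) (ε / 3) (by positivity)] with i hi
  rw [dist_zero_right, norm_norm] at hi ⊢
  rw [dist_eq_norm] at hab
  have h1 : ‖u i * (a - b)‖ ≤ ‖a - b‖ := by
    simpa using (norm_mul_le _ _).trans (mul_le_mul_of_nonneg_right (hu i) (norm_nonneg (a - b)))
  calc ‖u i * a - a‖ = ‖u i * (a - b) + (u i * b - b) - (a - b)‖ := by congr 1; noncomm_ring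
    _ ≤ ‖u i * (a - b)‖ + ‖u i * b - b‖ + ‖a - b‖ :=
      (norm_sub_le _ _).trans (by gcongr; exact norm_add_le _ _)
    _ < ε := by linarith

theorem norm_le_one_of_isPositive {H : Type*} [NormedAddCommGroup H] [InnerProductSpace ℂ H]
    [CompleteSpace H] {u : H →L[ℂ] H} (h0 : u.IsPositive) (h1 : (1 - u).IsPositive) : ‖u‖ ≤ 1 :=
  (CStarAlgebra.norm_le_one_iff_of_nonneg u
    ((ContinuousLinearMap.nonneg_iff_isPositive u).2 h0)).2 h1

open Classical in
/-- The point mass at `x`, as an element of `C₀(Y)`. -/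
def pointMass [DiscreteTopology Y] (x : Y) : C₀(Y, ℂ) where
  toFun := Pi.single x 1
  continuous_toFun := continuous_of_discreteTopology
  zero_at_infty' := by
    rw [cocompact_eq_cofinite]
    refine tendsto_const_nhds.congr' (EventuallyEq.symm ?_)
    filter_upwards [(Set.finite_singleton x).compl_mem_cofinite] with y hy
    exact Pi.single_eq_of_ne hy 1

open Classical in
theorem pointMass_apply [DiscreteTopology Y] (x y : Y) :
    pointMass x y = if y = x then 1 else 0 :=
  Pi.single_apply x 1 y

theorem tsupport_pointMass [DiscreteTopology Y] (x : Y) : tsupport ⇑(pointMass x) = {x} := by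
  ext y
  simp [tsupport, pointMass_apply]

theorem bandCompact_of_mem_roeAlgSet [DiscreteTopology Y]
    {ρ : C₀(Y, ℂ) →⋆ₙₐ[ℂ] (L2YN Y →L[ℂ] L2YN Y)}
    (hρ : ∀ (f : C₀(Y, ℂ)) (v : L2YN Y) (y : Y), (ρ f v) y = f y • v y)
    {T : L2YN Y →L[ℂ] L2YN Y} (hT : T ∈ RoeAlgSet ρ) : BandCompact T := by
  classical
  obtain ⟨hc, r, hr, hprop⟩ := hT
  have hsingle (y : Y) (w : L2N) :
      ρ (pointMass y) (lp.single 2 y w) = lp.single 2 y w := by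
    ext1; funext z
    rw [hρ, pointMass_apply]
    by_cases h : z = y
    · simp [h]
    · simp [h]
  refine ⟨fun x y => ?_, r + 1, by linarith, fun x y hxy => ?_⟩
  · have h : IsCompactOperator ⇑(lp.evalCLM ℂ (fun _ : Y => L2N) 2 x ∘L (T * ρ (pointMass y)) ∘L
        lp.singleContinuousLinearMap ℂ (fun _ : Y => L2N) 2 y) :=
      ((hc (pointMass y)).2.comp_clm (lp.singleContinuousLinearMap ℂ (fun _ : Y => L2N) 2 y)).clm_comp
        (lp.evalCLM ℂ (fun _ : Y => L2N) 2 x)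
    convert h using 2
    refine ContinuousLinearMap.ext fun w => ?_
    change _ = T (ρ (pointMass y) (lp.single 2 y w)) x
    rw [hsingle, matrixEntry_apply]
  · refine ContinuousLinearMap.ext fun w => ?_
    have h := hprop (pointMass x) (pointMass y) (by
      simp only [tsupport_pointMass, Set.mem_singleton_iff]
      rintro _ rfl _ rfl
      linarith)
    have h' := congrArg (fun S : L2YN Y →L[ℂ] L2YN Y => S (lp.single 2 y w) x) h
    simpa [hρ, hsingle, pointMass_apply, matrixEntry_apply] using h'

theorem isCompactOperator_mul_of_mem_diagCompactSet [DiscreteTopology Y]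
    {ρ : C₀(Y, ℂ) →⋆ₙₐ[ℂ] (L2YN Y →L[ℂ] L2YN Y)}
    (hρ : ∀ (f : C₀(Y, ℂ)) (v : L2YN Y) (y : Y), (ρ f v) y = f y • v y)
    {T : L2YN Y →L[ℂ] L2YN Y} (hT : T ∈ DiagCompactSet Y) (f : C₀(Y, ℂ)) :
    IsCompactOperator ⇑(ρ f * T) := by
  classical
  obtain ⟨k, hk, hTk⟩ := hT
  have hcl := isClosed_setOfPred_isCompactOperator (𝕜₁ := ℂ) (𝕜₂ := ℂ) (σ₁₂ := RingHom.id ℂ)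
    (M₁ := L2YN Y) (M₂ := L2YN Y)
  refine hcl.closure_subset (Metric.mem_closure_iff.2 fun ε hε => ?_)
  set δ := ε / (‖T‖ + 1) with hδ
  have hT0 : 0 < ‖T‖ + 1 := by positivity
  have hδ0 : 0 < δ := by positivity
  have hfin : {y | ¬ ‖f y‖ < δ}.Finite := by
    have h := f.zero_at_infty'
    rw [cocompact_eq_cofinite] at h
    have := Metric.tendsto_nhds.1 h δ hδ0
    simpa [Filter.eventually_cofinite] using this
  let S : L2YN Y →L[ℂ] L2YN Y := ∑ y ∈ hfin.toFinset,
    f y • (lp.singleContinuousLinearMap ℂ (fun _ : Y => L2N) 2 y ∘L k y ∘L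
      lp.evalCLM ℂ (fun _ : Y => L2N) 2 y)
  have hS (v : L2YN Y) (x : Y) : S v x = if ‖f x‖ < δ then 0 else f x • k x (v x) := by
    have h1 : S v x = ∑ y ∈ hfin.toFinset, if y = x then f x • k x (v x) else 0 := by
      simp only [S, _root_.sum_apply, lp.coeFn_sum, Finset.sum_apply]
      refine Finset.sum_congr rfl fun y _ => ?_
      change f y • (lp.single 2 y (k y (v y)) : L2YN Y) x = _
      split_ifs with h
      · subst h; simp
      · simp [Pi.single_eq_of_ne (Ne.symm h)]
    rw [h1, Finset.sum_ite_eq']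
    by_cases h : ‖f x‖ < δ <;> simp [h]
  refine ⟨S, ?_, ?_⟩
  · have hmem : S ∈ compactOperator (RingHom.id ℂ) (L2YN Y) (L2YN Y) :=
      Submodule.sum_mem _ fun y _ => Submodule.smul_mem _ _
        (((hk y).comp_clm (lp.evalCLM ℂ (fun _ : Y => L2N) 2 y)).clm_comp
          (lp.singleContinuousLinearMap ℂ (fun _ : Y => L2N) 2 y))
    exact hmem
  · have hle : ‖ρ f * T - S‖ ≤ δ * ‖T‖ := by
      refine ContinuousLinearMap.opNorm_le_bound _ (by positivity) fun v => ?_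
      have hmono : ‖(ρ f * T - S) v‖ ≤ ‖(δ : ℂ) • T v‖ := by
        refine lp.norm_mono two_ne_zero fun x => ?_
        change ‖ρ f (T v) x - S v x‖ ≤ ‖(δ : ℂ) • T v x‖
        rw [hρ, hS, hTk, norm_smul (δ : ℂ), Complex.norm_real, Real.norm_of_nonneg hδ0.le]
        split_ifs with h
        · rw [sub_zero, norm_smul]; gcongr
        · rw [sub_self, norm_zero]; positivity
      refine hmono.trans ?_
      rw [norm_smul, Complex.norm_real, Real.norm_of_nonneg hδ0.le, mul_assoc]
      gcongr
      exact T.le_opNorm v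
    rw [dist_eq_norm]
    refine hle.trans_lt ?_
    rw [hδ, div_mul_eq_mul_div, div_lt_iff₀ hT0]
    nlinarith

theorem diagCompactSet_subset_roeAlgSet [DiscreteTopology Y]
    {ρ : C₀(Y, ℂ) →⋆ₙₐ[ℂ] (L2YN Y →L[ℂ] L2YN Y)}
    (hρ : ∀ (f : C₀(Y, ℂ)) (v : L2YN Y) (y : Y), (ρ f v) y = f y • v y) :
    DiagCompactSet Y ⊆ RoeAlgSet ρ := by
  intro T hT
  have hcomm (f : C₀(Y, ℂ)) : T * ρ f = ρ f * T := by
    obtain ⟨k, -, hTk⟩ := hT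
    refine ContinuousLinearMap.ext fun v => ?_
    ext1; funext x
    simp only [mul_apply_eq_comp, hTk, hρ, map_smul]
  refine ⟨fun f => ⟨isCompactOperator_mul_of_mem_diagCompactSet hρ hT f, ?_⟩, 1, zero_le_one,
    fun f g hfg => ?_⟩
  · rw [hcomm]
    exact isCompactOperator_mul_of_mem_diagCompactSet hρ hT f
  · have h0 : f * g = 0 := by
      ext x
      by_contra hx
      obtain ⟨hf, hg⟩ := mul_ne_zero_iff.1 (show f x * g x ≠ 0 from hx)
      have := hfg x (subset_tsupport _ hf) x (subset_tsupport _ hg)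
      rw [dist_self] at this
      linarith
    rw [mul_assoc, hcomm, ← mul_assoc, ← map_mul, h0, map_zero, zero_mul]

/-- For a countable discrete metric space `Y` of bounded geometry, with
`C₀(Y)` acting by multiplication on `ℓ²(Y) ⊗ ℓ²(ℕ)`, the algebra
`A = ℓ∞(Y; K(ℓ²ℕ))` is contained in `ℝ(Y)` and every approximate unit of `A` is an
approximate unit for the reduced Roe algebra `C*_red(Y)` (the norm closure of `ℝ(Y)`). -/
theorem approx_unit_of_diagonal_subalgebra
    [Countable Y] [DiscreteTopology Y]
    (hbg : ∀ r : ℝ, 0 < r → ∃ N : ℕ, ∀ y : Y,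
      (Metric.ball y r).Finite ∧ (Metric.ball y r).ncard ≤ N)
    -- `ρ` is the multiplication representation of `C₀(Y)` on `ℓ²(Y) ⊗ ℓ²(ℕ)`
    (ρ : C₀(Y, ℂ) →⋆ₙₐ[ℂ] (L2YN Y →L[ℂ] L2YN Y))
    (hρ : ∀ (f : C₀(Y, ℂ)) (v : L2YN Y) (y : Y), (ρ f v) y = f y • v y) :
    -- A ⊆ ℝ(Y)
    DiagCompactSet Y ⊆ RoeAlgSet ρ ∧
    -- every approximate unit of A is an approximate unit of C*_red(Y)
    ∀ (ι : Type) [Preorder ι] [IsDirected ι (· ≤ ·)] [Nonempty ι] (unit : ι → L2YN Y →L[ℂ] L2YN Y),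
      (∀ i, unit i ∈ DiagCompactSet Y ∧ (unit i).IsPositive ∧ (1 - unit i).IsPositive) →
      (∀ a ∈ DiagCompactSet Y, Tendsto (fun i => ‖unit i * a - a‖) atTop (nhds 0)) →
      ∀ T ∈ closure (RoeAlgSet ρ),
        Tendsto (fun i => ‖unit i * T - T‖) atTop (nhds 0) ∧
        Tendsto (fun i => ‖T * unit i - T‖) atTop (nhds 0) := by
  refine ⟨diagCompactSet_subset_roeAlgSet hρ, fun ι _ _ _ unit hunit happrox T hT => ?_⟩
  have hnorm (i : ι) : ‖unit i‖ ≤ 1 := norm_le_one_of_isPositive (hunit i).2.1 (hunit i).2.2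
  have hleft : ∀ S ∈ closure {S : L2YN Y →L[ℂ] L2YN Y | BandCompact S},
      Tendsto (fun i => ‖unit i * S - S‖) atTop (nhds 0) := fun S hS =>
    tendsto_norm_mul_sub_of_mem_closure hnorm
      (fun _ h => tendsto_norm_mul_sub_of_bandCompact hbg happrox h) hS
  refine ⟨hleft T (closure_mono (fun _ h => bandCompact_of_mem_roeAlgSet hρ h) hT), ?_⟩
  have hstar : star T ∈ closure {S : L2YN Y →L[ℂ] L2YN Y | BandCompact S} :=
    map_mem_closure continuous_star hT fun _ h => (bandCompact_of_mem_roeAlgSet hρ h).adjoint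
  refine (hleft _ hstar).congr fun i => ?_
  rw [← norm_star, star_sub, star_mul, star_star, (hunit i).2.1.isSelfAdjoint.star_eq]
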